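/- arXiv:2304.14021 — 10 statements merged into one kernel-verified Lean document; each statement's English description precedes it below -/
import Mathlib

section
/- Let N ≥ 1 be an integer, Δt > 0, θ ∈ [0,1] and α > 0. Let ω₀ = exp(2πi/N), let F be the N×N complex Fourier matrix with entries F_{jk} = ω₀^{(j−1)(k−1)}/√N, let Γ_α = diag(1, α^{1/N}, …, α^{(N−1)/N}), and set V = Γ_α^{−1} F*, where F* is the conjugate transpose of F. Then V is invertible and the α-circulant matrices C₁^{(α)} and C₂^{(α)} are simultaneously diagonalized by V: C₁^{(α)} = V D₁ V^{−1} and C₂^{(α)} = V D₂ V^{−1}, where D₁ = diag(λ_{1,1},…,λ_{1,N}) with λ_{1,n} = (1 − α^{1/N} ω₀^{n−1})/Δt, and D₂ = diag(λ_{2,1},…,λ_{2,N}) with λ_{2,n} = θ + (1−θ) α^{1/N} ω₀^{n−1}, for n = 1,…,N. -/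
open Matrix

/-- The α-shift acts on a geometric vector as multiplication by `w⁻¹`. -/
lemma shift_sum (N : ℕ) (α w : ℂ) (hw : α * w ^ N = 1) (i : Fin N) :
    ∑ j : Fin N, ((if (i : ℕ) = (j : ℕ) + 1 then (1 : ℂ) else 0)
        + (if (i : ℕ) = 0 ∧ (j : ℕ) = N - 1 then α else 0)) * w ^ (j : ℕ) = w ^ (i : ℕ) * w⁻¹ := by
  obtain _ | M := N
  · exact i.elim0
  have hw0 : w ≠ 0 := by
    rintro rfl
    simp at hw
  induction i using Fin.cases with
  | zero =>
    rw [Finset.sum_eq_single (Fin.last M)]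
    · simp only [Fin.val_zero, Fin.val_last]
      rw [pow_succ] at hw
      simp
      field_simp
      linear_combination hw
    · intro b _ hb
      have : (b : ℕ) ≠ M := fun h => hb (Fin.ext (by simpa using h))
      simp [this]
    · simp
  | succ k =>
    rw [Finset.sum_eq_single k.castSucc]
    · simp [pow_succ, hw0]
    · intro b _ hb
      have : (k : ℕ) ≠ b := fun h => hb (Fin.ext (by simpa using h.symm))
      simp [this]
    · simp

/-- Conjugation from an intertwining relation checked on geometric columns. -/
lemma conj_aux (N : ℕ) (α c p q : ℂ) (w : Fin N → ℂ) (hw : ∀ n, α * w n ^ N = 1)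
    (V C D : Matrix (Fin N) (Fin N) ℂ) (hV : ∀ j n, V j n = c * w n ^ (j : ℕ)) (hu : IsUnit V)
    (hC : ∀ i j, C i j = p * (if i = j then 1 else 0)
      + q * ((if (i : ℕ) = (j : ℕ) + 1 then (1 : ℂ) else 0)
        + (if (i : ℕ) = 0 ∧ (j : ℕ) = N - 1 then α else 0)))
    (hD : D = Matrix.diagonal fun n => p + q * (w n)⁻¹) : C = V * D * V⁻¹ := by
  have h : C * V = V * D := by
    ext i n
    rw [hD, Matrix.mul_diagonal, Matrix.mul_apply]
    have hs := shift_sum N α (w n) (hw n) i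
    calc ∑ j, C i j * V j n = ∑ j, (p * c * ((if i = j then 1 else 0) * w n ^ (j : ℕ))
          + q * c * (((if (i : ℕ) = (j : ℕ) + 1 then (1 : ℂ) else 0)
        + (if (i : ℕ) = 0 ∧ (j : ℕ) = N - 1 then α else 0)) * w n ^ (j : ℕ))) := by
          refine Finset.sum_congr rfl fun j _ => ?_
          rw [hC, hV]; ring
      _ = _ := by
          rw [Finset.sum_add_distrib, ← Finset.mul_sum, ← Finset.mul_sum, hs, hV]
          simp
          ring
  rw [← h, Matrix.mul_assoc, Matrix.mul_nonsing_inv _ ((Matrix.isUnit_iff_isUnit_det _).1 hu),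
    Matrix.mul_one]

/-- Diagonalization of the Strang-type α-circulant matrices `C₁^{(α)}`, `C₂^{(α)}`
by `V = Γ_α⁻¹ F*`. -/
theorem alpha_circulant_diagonalization
    (N : ℕ) (hN : 1 ≤ N) (Δt θ α : ℝ) (hΔt : 0 < Δt)
    (hθ : θ ∈ Set.Icc (0 : ℝ) 1) (hα : 0 < α)
    (ω₀ : ℂ) (hω₀ : ω₀ = Complex.exp (2 * Real.pi * Complex.I / N))
    (F : Matrix (Fin N) (Fin N) ℂ)
    (hF : F = Matrix.of fun j k : Fin N =>
      ω₀ ^ ((j : ℕ) * (k : ℕ)) / (Real.sqrt N : ℂ))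
    (Γ : Matrix (Fin N) (Fin N) ℂ)
    (hΓ : Γ = Matrix.diagonal fun j : Fin N => ((α ^ (((j : ℕ) : ℝ) / N) : ℝ) : ℂ))
    (V : Matrix (Fin N) (Fin N) ℂ) (hV : V = Γ⁻¹ * Fᴴ)
    (C₁ C₂ : Matrix (Fin N) (Fin N) ℂ)
    (hC₁ : C₁ = Matrix.of fun i j : Fin N =>
      (if i = j then ((1 / Δt : ℝ) : ℂ) else 0)
        + (if (i : ℕ) = (j : ℕ) + 1 then ((-(1 / Δt) : ℝ) : ℂ) else 0)
        + (if (i : ℕ) = 0 ∧ (j : ℕ) = N - 1 then ((-(α / Δt) : ℝ) : ℂ) else 0))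
    (hC₂ : C₂ = Matrix.of fun i j : Fin N =>
      (if i = j then ((θ : ℝ) : ℂ) else 0)
        + (if (i : ℕ) = (j : ℕ) + 1 then ((1 - θ : ℝ) : ℂ) else 0)
        + (if (i : ℕ) = 0 ∧ (j : ℕ) = N - 1 then (((1 - θ) * α : ℝ) : ℂ) else 0))
    (D₁ D₂ : Matrix (Fin N) (Fin N) ℂ)
    (hD₁ : D₁ = Matrix.diagonal fun n : Fin N =>
      (1 - ((α ^ ((1 : ℝ) / N) : ℝ) : ℂ) * ω₀ ^ (n : ℕ)) / (Δt : ℂ))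
    (hD₂ : D₂ = Matrix.diagonal fun n : Fin N =>
      ((θ : ℝ) : ℂ) + ((1 - θ : ℝ) : ℂ) * ((α ^ ((1 : ℝ) / N) : ℝ) : ℂ) * ω₀ ^ (n : ℕ)) :
    IsUnit V ∧ C₁ = V * D₁ * V⁻¹ ∧ C₂ = V * D₂ * V⁻¹ := by
  have hN0 : N ≠ 0 := by omega
  have hNR : (N : ℝ) ≠ 0 := by exact_mod_cast hN0
  have hprim : IsPrimitiveRoot ω₀ N := by
    rw [hω₀]; exact Complex.isPrimitiveRoot_exp N hN0
  have hω0 : ω₀ ≠ 0 := hprim.ne_zero hN0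
  have hconj : star ω₀ = ω₀⁻¹ := by
    have hn : ‖ω₀‖ = 1 := hprim.norm'_eq_one hN0
    exact (Complex.inv_eq_conj hn).symm
  obtain ⟨a, ha⟩ : ∃ a : ℝ, a = α ^ ((1 : ℝ) / N) := ⟨_, rfl⟩
  have ha0 : 0 < a := ha ▸ Real.rpow_pos_of_pos hα _
  have hapow : ∀ j : ℕ, α ^ ((j : ℝ) / N) = a ^ j := by
    intro j
    rw [ha, ← Real.rpow_natCast, ← Real.rpow_mul hα.le]
    congr 1; ring
  have haN : a ^ N = α := by
    rw [← hapow, div_self hNR, Real.rpow_one]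
  have haC : (a : ℂ) ≠ 0 := by exact_mod_cast ha0.ne'
  have hαC : (α : ℂ) ≠ 0 := by exact_mod_cast hα.ne'
  have hΔC : (Δt : ℂ) ≠ 0 := by exact_mod_cast hΔt.ne'
  have hsq : ((Real.sqrt N : ℝ) : ℂ) ≠ 0 := by
    have : Real.sqrt N ≠ 0 := by positivity
    exact_mod_cast this
  let w : Fin N → ℂ := fun n => ((a : ℂ) * ω₀ ^ (n : ℕ))⁻¹
  have hw : ∀ n, (α : ℂ) * w n ^ N = 1 := by
    intro n
    have h1 : (a : ℂ) ^ N = α := by exact_mod_cast haN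
    have h2 : (ω₀ ^ (n : ℕ)) ^ N = 1 := by
      rw [← pow_mul, mul_comm, pow_mul, hprim.pow_eq_one, one_pow]
    simp only [w]
    rw [inv_pow, mul_pow, h1, h2, mul_one, mul_inv_cancel₀ hαC]
  have hΓi : Γ⁻¹ = Matrix.diagonal fun j : Fin N => ((a : ℂ) ^ (j : ℕ))⁻¹ := by
    apply Matrix.inv_eq_left_inv
    rw [hΓ, Matrix.diagonal_mul_diagonal, ← Matrix.diagonal_one]
    congr 1
    funext j
    rw [hapow, Complex.ofReal_pow]
    exact inv_mul_cancel₀ (pow_ne_zero _ haC)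
  have hVe : ∀ j n, V j n = ((Real.sqrt N : ℝ) : ℂ)⁻¹ * w n ^ (j : ℕ) := by
    intro j n
    rw [hV, hΓi, Matrix.diagonal_mul, Matrix.conjTranspose_apply, hF, Matrix.of_apply, star_div₀,
      star_pow, hconj]
    have : star ((Real.sqrt N : ℝ) : ℂ) = ((Real.sqrt N : ℝ) : ℂ) := Complex.conj_ofReal _
    rw [this]
    simp only [w]
    rw [mul_inv, mul_pow, inv_pow, inv_pow, inv_pow, ← pow_mul]
    ring
  have hwinj : Function.Injective w := by
    intro m n h
    have h1 := mul_left_cancel₀ haC (inv_injective h)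
    exact Fin.ext (hprim.pow_inj m.2 n.2 h1)
  have hu : IsUnit V := by
    have hVv : V = ((Real.sqrt N : ℝ) : ℂ)⁻¹ • (Matrix.vandermonde w)ᵀ := by
      ext j n
      rw [hVe]; simp [Matrix.vandermonde_apply]
    rw [Matrix.isUnit_iff_isUnit_det, isUnit_iff_ne_zero, hVv, Matrix.det_smul,
      Matrix.det_transpose]
    exact mul_ne_zero (pow_ne_zero _ (inv_ne_zero hsq))
      (Matrix.det_vandermonde_ne_zero_iff.2 hwinj)
  refine ⟨hu, ?_, ?_⟩
  · refine conj_aux N α _ (1 / Δt) (-(1 / Δt)) w hw V C₁ D₁ hVe hu ?_ ?_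
    · intro i j
      rw [hC₁, Matrix.of_apply]
      push_cast
      simp only [mul_add, mul_ite, mul_zero, mul_one, add_assoc]
      congr 3
      ring
    · rw [hD₁, ← ha]
      congr 1
      funext n
      simp only [w, inv_inv]
      ring
  · refine conj_aux N α _ θ (1 - θ) w hw V C₂ D₂ hVe hu ?_ ?_
    · intro i j
      rw [hC₂, Matrix.of_apply]
      push_cast
      simp only [mul_add, mul_ite, mul_zero, mul_one, add_assoc]
    · rw [hD₂, ← ha]
      congr 1
      funext n
      simp only [w, inv_inv]
      push_cast
      ring
end

section
/- (Error estimate at continuous level for the biharmonic heat equation, in Fourier modes.) Let T > 0, m > 0, and let α be a real number with |α| < 1. Let (ω_n)_{n∈ℤ} be real numbers with ω_n⁴ ≥ m for all n. For each k ≥ 0 let ê^k(t) ∈ ℓ² for every t ∈ [0,T], and suppose the modes satisfy ê^k_n(t) = e^{−ω_n⁴ t} ê^k_n(0) for all n ∈ ℤ, t ∈ [0,T] and k ≥ 0, together with the PinT coupling ê^k_n(0) = α (ê^k_n(T) − ê^{k−1}_n(T)) for all n ∈ ℤ and k ≥ 1. Then for every k ≥ 1 and every t ∈ [0,T], ‖ê^k(t)‖_{ℓ²}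 ≤ ρ^k ‖ê^0(0)‖_{ℓ²}, where ρ = |α| e^{−mT} / (1 − |α| e^{−mT}). -/
theorem lp_norm_le_of_pointwise (x y : lp (fun _ : ℤ => ℂ) 2) (C : ℝ) (hC : 0 ≤ C)
    (h : ∀ n, ‖(x : ∀ _ : ℤ, ℂ) n‖ ≤ C * ‖(y : ∀ _ : ℤ, ℂ) n‖) : ‖x‖ ≤ C * ‖y‖ := by
  have h2 : ‖x‖ ≤ ‖(C : ℂ) • y‖ := by
    apply lp.norm_mono (by norm_num)
    intro n
    have := h n
    rwa [lp.coeFn_smul, Pi.smul_apply, norm_smul, Complex.norm_real, Real.norm_of_nonneg hC]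
  rwa [norm_smul, Complex.norm_real, Real.norm_of_nonneg hC] at h2

/-- Error estimate at continuous level for the PinT waveform-relaxation iteration
for the biharmonic heat equation `u_t = -Δ²u`, in Fourier modes. -/
theorem biharmonic_pint_continuous_error_estimate
    (T m : ℝ) (hT : 0 < T) (hm : 0 < m)
    (α : ℝ) (hα : |α| < 1)
    (ω : ℤ → ℝ) (hω : ∀ n, m ≤ (ω n) ^ 4)
    (e : ℕ → ℝ → lp (fun _ : ℤ => ℂ) 2)
    (hmode : ∀ k : ℕ, ∀ n : ℤ, ∀ t ∈ Set.Icc (0 : ℝ) T,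
      (e k t : ∀ _ : ℤ, ℂ) n = (Real.exp (-(ω n) ^ 4 * t) : ℝ) * (e k 0 : ∀ _ : ℤ, ℂ) n)
    (hcoupling : ∀ k : ℕ, 1 ≤ k → ∀ n : ℤ,
      (e k 0 : ∀ _ : ℤ, ℂ) n = (α : ℂ) * ((e k T : ∀ _ : ℤ, ℂ) n - (e (k - 1) T : ∀ _ : ℤ, ℂ) n)) :
    ∀ k : ℕ, 1 ≤ k → ∀ t ∈ Set.Icc (0 : ℝ) T,
      ‖e k t‖ ≤ (|α| * Real.exp (-m * T) / (1 - |α| * Real.exp (-m * T))) ^ k * ‖e 0 0‖ := by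
  have hq : Real.exp (-m * T) < 1 := by
    rw [Real.exp_lt_one_iff]; nlinarith
  have hq0 := Real.exp_pos (-m * T)
  set q := Real.exp (-m * T) with hqdef
  have ha0 := abs_nonneg α
  have hd : 0 < 1 - |α| * q := by nlinarith
  have hρ : 0 ≤ |α| * q / (1 - |α| * q) := by positivity
  have hE : ∀ n, Real.exp (-(ω n) ^ 4 * T) ≤ q := by
    intro n
    apply Real.exp_le_exp.mpr
    nlinarith [hω n]
  have hTm : T ∈ Set.Icc (0 : ℝ) T := ⟨hT.le, le_refl T⟩
  have hnT : ∀ k, ‖e k T‖ ≤ q * ‖e k 0‖ := by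
    intro k
    apply lp_norm_le_of_pointwise _ _ _ hq0.le
    intro n
    rw [hmode k n T hTm, norm_mul, Complex.norm_real, Real.norm_of_nonneg (Real.exp_pos _).le]
    exact mul_le_mul_of_nonneg_right (hE n) (norm_nonneg _)
  have hnt : ∀ k, ∀ t ∈ Set.Icc (0 : ℝ) T, ‖e k t‖ ≤ ‖e k 0‖ := by
    intro k t ht
    rw [← one_mul ‖e k 0‖]
    apply lp_norm_le_of_pointwise _ _ _ zero_le_one
    intro n
    rw [hmode k n t ht, norm_mul, Complex.norm_real, Real.norm_of_nonneg (Real.exp_pos _).le]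
    refine mul_le_mul_of_nonneg_right (Real.exp_le_one_iff.mpr ?_) (norm_nonneg _)
    nlinarith [hω n, ht.1]
  have hstep : ∀ k, ‖e (k + 1) 0‖ ≤ |α| * q / (1 - |α| * q) * ‖e k 0‖ := by
    intro k
    have h1 : ‖e (k + 1) 0‖ ≤ |α| * ‖e (k + 1) T - e k T‖ := by
      apply lp_norm_le_of_pointwise _ _ _ ha0
      intro n
      rw [hcoupling (k + 1) (by omega) n]
      simp
    have h2 := norm_sub_le (e (k + 1) T) (e k T)
    have h3 : ‖e (k + 1) T - e k T‖ ≤ q * ‖e (k + 1) 0‖ + q * ‖e k 0‖ := by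
      linarith [hnT (k + 1), hnT k]
    have h4 := mul_le_mul_of_nonneg_left h3 ha0
    rw [div_mul_eq_mul_div, le_div_iff₀ hd]
    linarith
  have hall : ∀ k, ‖e k 0‖ ≤ (|α| * q / (1 - |α| * q)) ^ k * ‖e 0 0‖ := by
    intro k
    induction k with
    | zero => simp
    | succ k ih =>
      calc _ ≤ _ := hstep k
        _ ≤ _ := mul_le_mul_of_nonneg_left ih hρ
        _ = _ := by ring
  intro k _ t ht
  exact (hnt k t ht).trans (hall k)
end

section
/- (Error estimate at fully discrete level for the biharmonic heat equation.) Let N ≥ 1, N_t ≥ 1, Δt > 0, and let α be a real number with |α| < 1/2. Let θ = 1 or θ = 1/2. Let Q be an invertible N×N real matrix and D an N×N diagonal real matrix with nonnegative diagonal entries, and set A = Q D Q^{−1}. For each k ≥ 0 let e_0^k, e_1^k, …, e_{N_t}^k ∈ ℝ^N satisfy (I + θΔt A) e_n^k = (I − (1−θ)Δt A) e_{n−1}^k for n = 1,…,N_t, and suppose e_0^k = α (e_{N_t}^k − e_{N_t}^{k−1}) for all k ≥ 1. Then for every k ≥ 1, max_{1 ≤ n ≤ N_t} ‖Q^{−1}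 e_n^k‖_∞ ≤ (|α|/(1−|α|))^k ‖Q^{−1} e_0^0‖_∞. -/
open Matrix

/-- Error estimate at fully discrete level for the PinT iteration for the
biharmonic heat equation with the linear θ-method (θ = 1: backward Euler,
θ = 1/2: trapezoidal rule). The norm on `Fin N → ℝ` is the sup norm. -/
theorem biharmonic_pint_fully_discrete_error_estimate
    (N Nt : ℕ) (hN : 1 ≤ N) (hNt : 1 ≤ Nt) (Δt : ℝ) (hΔt : 0 < Δt)
    (α : ℝ) (hα : |α| < 1 / 2)
    (θ : ℝ) (hθ : θ = 1 ∨ θ = 1 / 2)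
    (Q : Matrix (Fin N) (Fin N) ℝ) (hQ : IsUnit Q)
    (d : Fin N → ℝ) (hd : ∀ i, 0 ≤ d i)
    (A : Matrix (Fin N) (Fin N) ℝ) (hA : A = Q * Matrix.diagonal d * Q⁻¹)
    (e : ℕ → ℕ → Fin N → ℝ)
    (hrec : ∀ k : ℕ, ∀ n : ℕ, 1 ≤ n → n ≤ Nt →
      ((1 : Matrix (Fin N) (Fin N) ℝ) + (θ * Δt) • A).mulVec (e k n)
        = ((1 : Matrix (Fin N) (Fin N) ℝ) - ((1 - θ) * Δt) • A).mulVec (e k (n - 1)))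
    (hcoupling : ∀ k : ℕ, 1 ≤ k → e k 0 = α • (e k Nt - e (k - 1) Nt)) :
    ∀ k : ℕ, 1 ≤ k → ∀ n : ℕ, 1 ≤ n → n ≤ Nt →
      ‖Q⁻¹.mulVec (e k n)‖ ≤ (|α| / (1 - |α|)) ^ k * ‖Q⁻¹.mulVec (e 0 0)‖ := by
  have hdet : IsUnit Q.det := (Matrix.isUnit_iff_isUnit_det Q).mp hQ
  have hQA : Q⁻¹ * A = Matrix.diagonal d * Q⁻¹ := by
    rw [hA, Matrix.mul_assoc Q, Matrix.nonsing_inv_mul_cancel_left _ _ hdet]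
  have key : ∀ (v : Fin N → ℝ) (i : Fin N),
      (Q⁻¹.mulVec (A.mulVec v)) i = d i * (Q⁻¹.mulVec v) i := by
    intro v i
    rw [Matrix.mulVec_mulVec, hQA, ← Matrix.mulVec_mulVec, Matrix.mulVec_diagonal]
  have hstep : ∀ k n : ℕ, 1 ≤ n → n ≤ Nt →
      ‖Q⁻¹.mulVec (e k n)‖ ≤ ‖Q⁻¹.mulVec (e k (n - 1))‖ := by
    intro k n h1 h2
    refine (pi_norm_le_iff_of_nonneg (norm_nonneg _)).mpr fun i => ?_
    refine le_trans ?_ (norm_le_pi_norm _ i)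
    have h := congrFun (congrArg (Q⁻¹.mulVec) (hrec k n h1 h2)) i
    simp only [Matrix.add_mulVec, Matrix.sub_mulVec, Matrix.one_mulVec, Matrix.smul_mulVec,
      Matrix.mulVec_add, Matrix.mulVec_sub, Matrix.mulVec_smul, Pi.add_apply, Pi.sub_apply,
      Pi.smul_apply, smul_eq_mul, key] at h
    generalize (Q⁻¹.mulVec (e k n)) i = a at h ⊢
    generalize (Q⁻¹.mulVec (e k (n - 1))) i = b at h ⊢
    have hz : 0 ≤ Δt * d i := mul_nonneg hΔt.le (hd i)
    generalize hzz : Δt * d i = z at hz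
    have h' : (1 + θ * z) * a = (1 - (1 - θ) * z) * b := by
      rw [← hzz]; linarith
    have hpos : 0 < 1 + θ * z := by
      rcases hθ with rfl | rfl <;> linarith
    have hle : |1 - (1 - θ) * z| ≤ 1 + θ * z := by
      rw [abs_le]
      rcases hθ with rfl | rfl <;> constructor <;> linarith
    have h3 := congrArg abs h'
    rw [abs_mul, abs_mul, abs_of_pos hpos] at h3
    rw [Real.norm_eq_abs, Real.norm_eq_abs]
    refine le_of_mul_le_mul_left ?_ hpos
    rw [h3]
    exact mul_le_mul_of_nonneg_right hle (abs_nonneg b)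
  have hall : ∀ k n : ℕ, n ≤ Nt → ‖Q⁻¹.mulVec (e k n)‖ ≤ ‖Q⁻¹.mulVec (e k 0)‖ := by
    intro k n
    induction n with
    | zero => intro _; exact le_rfl
    | succ m ih =>
      intro h
      exact (hstep k (m + 1) (by omega) h).trans (ih (by omega))
  have hpos : 0 < 1 - |α| := by linarith
  have h0 : ∀ k : ℕ, ‖Q⁻¹.mulVec (e k 0)‖
      ≤ (|α| / (1 - |α|)) ^ k * ‖Q⁻¹.mulVec (e 0 0)‖ := by
    intro k
    induction k with
    | zero => simp
    | succ m ih =>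
      have hc := hcoupling (m + 1) (by omega)
      rw [Nat.add_sub_cancel] at hc
      have h1 : ‖Q⁻¹.mulVec (e (m + 1) 0)‖
          ≤ |α| * (‖Q⁻¹.mulVec (e (m + 1) 0)‖ + ‖Q⁻¹.mulVec (e m 0)‖) := by
        conv_lhs => rw [hc, Matrix.mulVec_smul, Matrix.mulVec_sub, norm_smul, Real.norm_eq_abs]
        refine mul_le_mul_of_nonneg_left ?_ (abs_nonneg α)
        exact (norm_sub_le _ _).trans (add_le_add (hall _ _ le_rfl) (hall _ _ le_rfl))
      have h2 : ‖Q⁻¹.mulVec (e (m + 1) 0)‖ ≤ |α| / (1 - |α|) * ‖Q⁻¹.mulVec (e m 0)‖ := by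
        rw [div_mul_eq_mul_div, le_div_iff₀ hpos]
        linarith
      rw [pow_succ', mul_assoc]
      exact h2.trans (mul_le_mul_of_nonneg_left ih (div_nonneg (abs_nonneg α) hpos.le))
  intro k _ n _ hn
  exact (hall k n hn).trans (h0 k)
end

section
/- (Error estimate at continuous level for the linearized Cahn–Hilliard equation, in Fourier modes.) Let T > 0, ε > 0, β ∈ ℝ, and set C = β⁴T/(4ε²). Let α be a real number with |α| e^{C} < 1. Let (ω_n)_{n∈ℤ} be real numbers, and for each k ≥ 0 let ê^k(t) ∈ ℓ² for every t ∈ [0,T], with modes satisfying ê^k_n(t) = e^{(β²ω_n² − ε²ω_n⁴) t} ê^k_n(0) for all n ∈ ℤ, t ∈ [0,T], k ≥ 0, together with the PinT coupling ê^k_n(0) = α (ê^k_n(T) − ê^{k−1}_n(T)) for all n ∈ ℤ and k ≥ 1. Then for every k ≥ 1 and every t ∈ [0,T], ‖ê^k(t)‖_{ℓ²} ≤ e^{C} ρ^k ‖ê^0(0)‖_{ℓ²}, where ρ = |α| e^{C} / (1 − |α| e^{C}). -/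
/-- Error estimate at continuous level for the PinT iteration for the linearized
Cahn–Hilliard equation `u_t = -β²Δu - ε²Δ²u`, in Fourier modes, with
`C = β⁴T/(4ε²)`. -/
theorem linearized_CH_pint_continuous_error_estimate
    (T ε β : ℝ) (hT : 0 < T) (hε : 0 < ε)
    (C : ℝ) (hC : C = β ^ 4 * T / (4 * ε ^ 2))
    (α : ℝ) (hα : |α| * Real.exp C < 1)
    (ω : ℤ → ℝ)
    (e : ℕ → ℝ → lp (fun _ : ℤ => ℂ) 2)
    (hmode : ∀ k : ℕ, ∀ n : ℤ, ∀ t ∈ Set.Icc (0 : ℝ) T,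
      (e k t : ∀ _ : ℤ, ℂ) n
        = (Real.exp ((β ^ 2 * (ω n) ^ 2 - ε ^ 2 * (ω n) ^ 4) * t) : ℝ)
            * (e k 0 : ∀ _ : ℤ, ℂ) n)
    (hcoupling : ∀ k : ℕ, 1 ≤ k → ∀ n : ℤ,
      (e k 0 : ∀ _ : ℤ, ℂ) n
        = (α : ℂ) * ((e k T : ∀ _ : ℤ, ℂ) n - (e (k - 1) T : ∀ _ : ℤ, ℂ) n)) :
    ∀ k : ℕ, 1 ≤ k → ∀ t ∈ Set.Icc (0 : ℝ) T,
      ‖e k t‖ ≤ Real.exp C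
        * (|α| * Real.exp C / (1 - |α| * Real.exp C)) ^ k * ‖e 0 0‖ := by
  have hexp : ∀ n : ℤ, ∀ t ∈ Set.Icc (0 : ℝ) T,
      (β ^ 2 * (ω n) ^ 2 - ε ^ 2 * (ω n) ^ 4) * t ≤ C := by
    intro n t ht
    have h1 : β ^ 2 * (ω n) ^ 2 - ε ^ 2 * (ω n) ^ 4 ≤ β ^ 4 / (4 * ε ^ 2) := by
      rw [le_div_iff₀ (by positivity)]
      nlinarith [sq_nonneg (β ^ 2 - 2 * ε ^ 2 * (ω n) ^ 2)]
    have h2 : 0 ≤ β ^ 4 / (4 * ε ^ 2) := by positivity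
    calc _ ≤ β ^ 4 / (4 * ε ^ 2) * t := mul_le_mul_of_nonneg_right h1 ht.1
      _ ≤ β ^ 4 / (4 * ε ^ 2) * T := mul_le_mul_of_nonneg_left ht.2 h2
      _ = C := by rw [hC]; ring
  have hbound : ∀ k : ℕ, ∀ t ∈ Set.Icc (0 : ℝ) T,
      ‖e k t‖ ≤ Real.exp C * ‖e k 0‖ := by
    intro k t ht
    have h : ‖e k t‖ ≤ ‖((Real.exp C : ℝ) : ℂ) • e k 0‖ := by
      refine lp.norm_mono (by norm_num) ?_
      intro n
      rw [hmode k n t ht, lp.coeFn_smul, Pi.smul_apply, smul_eq_mul, norm_mul, norm_mul,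
        Complex.norm_real, Complex.norm_real, Real.norm_of_nonneg (Real.exp_pos _).le,
        Real.norm_of_nonneg (Real.exp_pos _).le]
      exact mul_le_mul_of_nonneg_right (Real.exp_le_exp.2 (hexp n t ht)) (norm_nonneg _)
    rwa [norm_smul, Complex.norm_real, Real.norm_of_nonneg (Real.exp_pos _).le] at h
  have hTm : T ∈ Set.Icc (0 : ℝ) T := ⟨hT.le, le_rfl⟩
  have hpos : 0 < 1 - |α| * Real.exp C := by linarith
  have hstep : ∀ k : ℕ, ‖e (k + 1) 0‖ ≤
      |α| * Real.exp C / (1 - |α| * Real.exp C) * ‖e k 0‖ := by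
    intro k
    have heq : e (k + 1) 0 = (α : ℂ) • (e (k + 1) T - e k T) := by
      ext n
      rw [hcoupling (k + 1) (by omega) n]
      rfl
    have h1 : ‖e (k + 1) 0‖ ≤ |α| * (Real.exp C * ‖e (k + 1) 0‖ + Real.exp C * ‖e k 0‖) := by
      calc ‖e (k + 1) 0‖ = |α| * ‖e (k + 1) T - e k T‖ := by
            conv_lhs => rw [heq]
            rw [norm_smul, Complex.norm_real, Real.norm_eq_abs]
        _ ≤ _ := mul_le_mul_of_nonneg_left ((norm_sub_le _ _).trans
            (add_le_add (hbound _ T hTm) (hbound _ T hTm))) (abs_nonneg _)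
    rw [div_mul_eq_mul_div, le_div_iff₀ hpos]
    linarith
  have hρ : 0 ≤ |α| * Real.exp C / (1 - |α| * Real.exp C) := by positivity
  have hall : ∀ k : ℕ, ‖e k 0‖ ≤
      (|α| * Real.exp C / (1 - |α| * Real.exp C)) ^ k * ‖e 0 0‖ := by
    intro k
    induction k with
    | zero => simp
    | succ k ih =>
      refine (hstep k).trans ((mul_le_mul_of_nonneg_left ih hρ).trans_eq ?_)
      ring
  intro k _ t ht
  rw [mul_assoc]
  exact (hbound k t ht).trans (mul_le_mul_of_nonneg_left (hall k) (Real.exp_pos _).le)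
end

section
/- (Error estimate at fully discrete level for the linearized Cahn–Hilliard equation, backward Euler.) Let N ≥ 1, N_t ≥ 1, ε > 0, β ∈ ℝ, and Δt > 0 with β⁴Δt < 4ε². Set r = 1/(1 − β⁴Δt/(4ε²)) and let α be a real number with |α| r^{N_t} < 1. Let Q be an invertible N×N real matrix and D an N×N diagonal real matrix each of whose diagonal entries has the form β²λ + ε²λ² for some real λ ≤ 0, and set A = Q D Q^{−1}. Then I + Δt A is invertible; moreover, if for each k ≥ 0 the vectors e_0^k, …, e_{N_t}^k ∈ ℝ^N satisfy (I + Δt A) e_n^k = e_{n−1}^k for n = 1,…,N_t, and e_0^k = α (e_{N_t}^k − e_{N_t}^{k−1}) for k ≥ 1, then for every k ≥ 1, max_{1 ≤ n ≤ N_t} ‖Q^{−1} e_n^k‖_∞ ≤ r^{N_t} ρ^k ‖Q^{−1} e_0^0‖_∞, where ρ = |α| r^{N_t} / (1 − |α| r^{N_t}). -/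
open Matrix

/-- Error estimate at fully discrete level for the PinT iteration for the
linearized Cahn–Hilliard equation with backward Euler. The norm on
`Fin N → ℝ` is the sup norm. -/
theorem linearized_CH_pint_backward_euler_error_estimate
    (N Nt : ℕ) (hN : 1 ≤ N) (hNt : 1 ≤ Nt) (ε β Δt : ℝ) (hε : 0 < ε) (hΔt : 0 < Δt)
    (hstab : β ^ 4 * Δt < 4 * ε ^ 2)
    (r : ℝ) (hr : r = 1 / (1 - β ^ 4 * Δt / (4 * ε ^ 2)))
    (α : ℝ) (hα : |α| * r ^ Nt < 1)
    (Q : Matrix (Fin N) (Fin N) ℝ) (hQ : IsUnit Q)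
    (d : Fin N → ℝ) (hd : ∀ i, ∃ l : ℝ, l ≤ 0 ∧ d i = β ^ 2 * l + ε ^ 2 * l ^ 2)
    (A : Matrix (Fin N) (Fin N) ℝ) (hA : A = Q * Matrix.diagonal d * Q⁻¹) :
    IsUnit ((1 : Matrix (Fin N) (Fin N) ℝ) + Δt • A)
      ∧ ∀ e : ℕ → ℕ → Fin N → ℝ,
        (∀ k : ℕ, ∀ n : ℕ, 1 ≤ n → n ≤ Nt →
          ((1 : Matrix (Fin N) (Fin N) ℝ) + Δt • A).mulVec (e k n) = e k (n - 1)) →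
        (∀ k : ℕ, 1 ≤ k → e k 0 = α • (e k Nt - e (k - 1) Nt)) →
        ∀ k : ℕ, 1 ≤ k → ∀ n : ℕ, 1 ≤ n → n ≤ Nt →
          ‖Q⁻¹.mulVec (e k n)‖
            ≤ r ^ Nt * (|α| * r ^ Nt / (1 - |α| * r ^ Nt)) ^ k
              * ‖Q⁻¹.mulVec (e 0 0)‖ := by
  have hdet : IsUnit Q.det := (Matrix.isUnit_iff_isUnit_det Q).1 hQ
  have hQQ : Q * Q⁻¹ = 1 := Matrix.mul_nonsing_inv Q hdet
  have hQQ' : Q⁻¹ * Q = 1 := Matrix.nonsing_inv_mul Q hdet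
  have hε2 : 0 < 4 * ε ^ 2 := by positivity
  have hq0 : 0 ≤ β ^ 4 * Δt / (4 * ε ^ 2) := by positivity
  have hq1 : β ^ 4 * Δt / (4 * ε ^ 2) < 1 := (div_lt_one hε2).2 hstab
  have hr1 : 1 ≤ r := by
    rw [hr, le_div_iff₀ (by linarith)]; linarith
  have hr0 : 0 < r := by linarith
  have hrs : r * (1 - β ^ 4 * Δt / (4 * ε ^ 2)) = 1 := by
    rw [hr]; exact one_div_mul_cancel (by linarith)
  have hlow : ∀ i, 1 - β ^ 4 * Δt / (4 * ε ^ 2) ≤ 1 + Δt * d i := by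
    intro i
    obtain ⟨l, -, hl⟩ := hd i
    have : 1 + Δt * d i - (1 - β ^ 4 * Δt / (4 * ε ^ 2))
        = Δt * (β ^ 2 + 2 * ε ^ 2 * l) ^ 2 / (4 * ε ^ 2) := by
      rw [hl]; field_simp; ring
    have h2 : 0 ≤ Δt * (β ^ 2 + 2 * ε ^ 2 * l) ^ 2 / (4 * ε ^ 2) := by positivity
    linarith
  have hpos : ∀ i, 0 < 1 + Δt * d i := fun i => by linarith [hlow i]
  have hone : ∀ i, 1 ≤ r * (1 + Δt * d i) := fun i => by
    exact hrs.symm.le.trans (mul_le_mul_of_nonneg_left (hlow i) hr0.le)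
  have hdiag : Matrix.diagonal (fun i => 1 + Δt * d i)
      = (1 : Matrix (Fin N) (Fin N) ℝ) + Δt • Matrix.diagonal d := by
    ext i j
    by_cases h : i = j
    · subst h; simp
    · simp [h]
  have hM : (1 : Matrix (Fin N) (Fin N) ℝ) + Δt • A
      = Q * Matrix.diagonal (fun i => 1 + Δt * d i) * Q⁻¹ := by
    rw [hdiag, hA, mul_add, add_mul, mul_one, hQQ, Matrix.mul_smul, Matrix.smul_mul]
  have hcomm : Q⁻¹ * ((1 : Matrix (Fin N) (Fin N) ℝ) + Δt • A)
      = Matrix.diagonal (fun i => 1 + Δt * d i) * Q⁻¹ := by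
    rw [hM, ← mul_assoc, ← mul_assoc, hQQ', one_mul]
  refine ⟨?_, ?_⟩
  · rw [hM]
    have h1 : IsUnit (Matrix.diagonal (fun i => 1 + Δt * d i)) := by
      rw [Matrix.isUnit_iff_isUnit_det, Matrix.det_diagonal]
      exact (Finset.prod_pos fun i _ => hpos i).ne'.isUnit
    exact (hQ.mul h1).mul ((Matrix.isUnit_nonsing_inv_iff).2 hQ)
  · intro e he h0
    have hstep : ∀ k n, n + 1 ≤ Nt →
        ‖Q⁻¹.mulVec (e k (n + 1))‖ ≤ r * ‖Q⁻¹.mulVec (e k n)‖ := by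
      intro k n hn
      have h := he k (n + 1) (by omega) hn
      rw [Nat.add_sub_cancel] at h
      have h2 : Q⁻¹.mulVec (e k n)
          = (Matrix.diagonal (fun i => 1 + Δt * d i)).mulVec (Q⁻¹.mulVec (e k (n + 1))) := by
        rw [← h, Matrix.mulVec_mulVec, Matrix.mulVec_mulVec, hcomm]
      refine (pi_norm_le_iff_of_nonneg (by positivity)).2 fun i => ?_
      have h3 := congrFun h2 i
      rw [Matrix.mulVec_diagonal] at h3
      have h4 : ‖Q⁻¹.mulVec (e k n) i‖ ≤ ‖Q⁻¹.mulVec (e k n)‖ := norm_le_pi_norm _ i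
      rw [h3, norm_mul, Real.norm_of_nonneg (hpos i).le] at h4
      calc ‖Q⁻¹.mulVec (e k (n + 1)) i‖
          ≤ (r * (1 + Δt * d i)) * ‖Q⁻¹.mulVec (e k (n + 1)) i‖ :=
            le_mul_of_one_le_left (norm_nonneg _) (hone i)
        _ = r * ((1 + Δt * d i) * ‖Q⁻¹.mulVec (e k (n + 1)) i‖) := by ring
        _ ≤ _ := mul_le_mul_of_nonneg_left h4 hr0.le
    have hpow : ∀ k n, n ≤ Nt → ‖Q⁻¹.mulVec (e k n)‖ ≤ r ^ n * ‖Q⁻¹.mulVec (e k 0)‖ := by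
      intro k n
      induction n with
      | zero => intro _; simp
      | succ n ih =>
        intro hn
        calc _ ≤ r * ‖Q⁻¹.mulVec (e k n)‖ := hstep k n hn
          _ ≤ r * (r ^ n * ‖Q⁻¹.mulVec (e k 0)‖) :=
            mul_le_mul_of_nonneg_left (ih (by omega)) hr0.le
          _ = _ := by ring
    have hden : 0 < 1 - |α| * r ^ Nt := by linarith
    have hρ : 0 ≤ |α| * r ^ Nt / (1 - |α| * r ^ Nt) := by positivity
    have hk : ∀ k, ‖Q⁻¹.mulVec (e k 0)‖
        ≤ (|α| * r ^ Nt / (1 - |α| * r ^ Nt)) ^ k * ‖Q⁻¹.mulVec (e 0 0)‖ := by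
      intro k
      induction k with
      | zero => simp
      | succ k ih =>
        have h := h0 (k + 1) (by omega)
        rw [Nat.add_sub_cancel] at h
        have h1 : ‖Q⁻¹.mulVec (e (k + 1) 0)‖
            ≤ |α| * (‖Q⁻¹.mulVec (e (k + 1) Nt)‖ + ‖Q⁻¹.mulVec (e k Nt)‖) := by
          rw [h, Matrix.mulVec_smul, Matrix.mulVec_sub, norm_smul, Real.norm_eq_abs]
          exact mul_le_mul_of_nonneg_left (norm_sub_le _ _) (abs_nonneg _)
        have h2 : |α| * (‖Q⁻¹.mulVec (e (k + 1) Nt)‖ + ‖Q⁻¹.mulVec (e k Nt)‖)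
            ≤ |α| * (r ^ Nt * ‖Q⁻¹.mulVec (e (k + 1) 0)‖ + r ^ Nt * ‖Q⁻¹.mulVec (e k 0)‖) :=
          mul_le_mul_of_nonneg_left
            (add_le_add (hpow (k + 1) Nt le_rfl) (hpow k Nt le_rfl)) (abs_nonneg _)
        have h3 : ‖Q⁻¹.mulVec (e (k + 1) 0)‖
            ≤ |α| * r ^ Nt / (1 - |α| * r ^ Nt) * ‖Q⁻¹.mulVec (e k 0)‖ := by
          rw [div_mul_eq_mul_div, le_div_iff₀ hden]
          nlinarith
        calc _ ≤ _ := h3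
          _ ≤ _ := mul_le_mul_of_nonneg_left ih hρ
          _ = _ := by ring
    intro k _ n _ hn
    calc _ ≤ r ^ n * ‖Q⁻¹.mulVec (e k 0)‖ := hpow k n hn
      _ ≤ r ^ Nt * ‖Q⁻¹.mulVec (e k 0)‖ :=
        mul_le_mul_of_nonneg_right (pow_le_pow_right₀ hr1 hn) (norm_nonneg _)
      _ ≤ r ^ Nt * ((|α| * r ^ Nt / (1 - |α| * r ^ Nt)) ^ k * ‖Q⁻¹.mulVec (e 0 0)‖) :=
        mul_le_mul_of_nonneg_left (hk k) (by positivity)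
      _ = _ := by ring
end

section
/- (Error estimate at fully discrete level for the linearized Cahn–Hilliard equation, trapezoidal rule.) Let N ≥ 1, N_t ≥ 1, ε > 0, β ∈ ℝ, and Δt > 0 with β⁴Δt < 8ε². Set δ = β⁴Δt/(4ε²), r = (1 + δ/2)/(1 − δ/2), and let α be a real number with |α| r^{N_t} < 1. Let Q be an invertible N×N real matrix and D an N×N diagonal real matrix each of whose diagonal entries has the form β²λ + ε²λ² for some real λ ≤ 0, and set A = Q D Q^{−1}. Then I + (Δt/2) A is invertible; moreover, if for each k ≥ 0 the vectors e_0^k, …, e_{N_t}^k ∈ ℝ^N satisfy (I + (Δt/2) A) e_n^k = (I − (Δt/2) A) e_{n−1}^k for n = 1,…,N_t, and e_0^k = α (e_{N_t}^k − e_{N_t}^{k−1}) for k ≥ 1, then for every k ≥ 1, max_{1 ≤ n ≤ N_t} ‖Q^{−1} e_n^k‖_∞ ≤ r^{N_t} ρ^k ‖Q^{−1} e_0^0‖_∞, where ρ = |α| r^{N_t} / (1 − |α| r^{N_t}). -/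
open Matrix

/-- Error estimate at fully discrete level for the PinT iteration for the
linearized Cahn–Hilliard equation with the trapezoidal rule. The norm on
`Fin N → ℝ` is the sup norm. -/
theorem linearized_CH_pint_trapezoidal_error_estimate
    (N Nt : ℕ) (hN : 1 ≤ N) (hNt : 1 ≤ Nt) (ε β Δt : ℝ) (hε : 0 < ε) (hΔt : 0 < Δt)
    (hstab : β ^ 4 * Δt < 8 * ε ^ 2)
    (δ : ℝ) (hδ : δ = β ^ 4 * Δt / (4 * ε ^ 2))
    (r : ℝ) (hr : r = (1 + δ / 2) / (1 - δ / 2))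
    (α : ℝ) (hα : |α| * r ^ Nt < 1)
    (Q : Matrix (Fin N) (Fin N) ℝ) (hQ : IsUnit Q)
    (d : Fin N → ℝ) (hd : ∀ i, ∃ l : ℝ, l ≤ 0 ∧ d i = β ^ 2 * l + ε ^ 2 * l ^ 2)
    (A : Matrix (Fin N) (Fin N) ℝ) (hA : A = Q * Matrix.diagonal d * Q⁻¹) :
    IsUnit ((1 : Matrix (Fin N) (Fin N) ℝ) + (Δt / 2) • A)
      ∧ ∀ e : ℕ → ℕ → Fin N → ℝ,
        (∀ k : ℕ, ∀ n : ℕ, 1 ≤ n → n ≤ Nt →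
          ((1 : Matrix (Fin N) (Fin N) ℝ) + (Δt / 2) • A).mulVec (e k n)
            = ((1 : Matrix (Fin N) (Fin N) ℝ) - (Δt / 2) • A).mulVec (e k (n - 1))) →
        (∀ k : ℕ, 1 ≤ k → e k 0 = α • (e k Nt - e (k - 1) Nt)) →
        ∀ k : ℕ, 1 ≤ k → ∀ n : ℕ, 1 ≤ n → n ≤ Nt →
          ‖Q⁻¹.mulVec (e k n)‖
            ≤ r ^ Nt * (|α| * r ^ Nt / (1 - |α| * r ^ Nt)) ^ k
              * ‖Q⁻¹.mulVec (e 0 0)‖ := by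
  have hdet : IsUnit Q.det := (Matrix.isUnit_iff_isUnit_det Q).mp hQ
  have hQQ : Q * Q⁻¹ = 1 := Matrix.mul_nonsing_inv Q hdet
  have hQQ' : Q⁻¹ * Q = 1 := Matrix.nonsing_inv_mul Q hdet
  have hε2 : 0 < ε ^ 2 := by positivity
  have hδ0 : 0 ≤ δ := by rw [hδ]; positivity
  have hδ2 : δ < 2 := by
    rw [hδ, div_lt_iff₀ (by positivity)]; linarith
  have hr1 : 1 ≤ r := by
    rw [hr, le_div_iff₀ (by linarith)]; linarith
  have hr0 : 0 ≤ r := by linarith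
  have hrδ : r * (1 - δ / 2) = 1 + δ / 2 := by
    rw [hr]; exact div_mul_cancel₀ _ (by linarith)
  have hx : ∀ i, -(δ / 2) ≤ Δt / 2 * d i := by
    intro i
    obtain ⟨l, hl, hdl⟩ := hd i
    have h1 : -(β ^ 4 / (4 * ε ^ 2)) ≤ d i := by
      rw [hdl, ← neg_div, div_le_iff₀ (by positivity)]
      nlinarith [sq_nonneg (β ^ 2 + 2 * ε ^ 2 * l)]
    have h2 : δ / 2 = Δt / 2 * (β ^ 4 / (4 * ε ^ 2)) := by rw [hδ]; ring
    rw [h2]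
    nlinarith
  have hpos : ∀ i, 0 < 1 + Δt / 2 * d i := fun i => by linarith [hx i]
  have hbd : ∀ i, |1 - Δt / 2 * d i| ≤ r * (1 + Δt / 2 * d i) := by
    intro i
    have := hx i
    rw [abs_le]
    constructor <;> nlinarith
  have hplus : (1 : Matrix (Fin N) (Fin N) ℝ) + (Δt / 2) • A
      = Q * Matrix.diagonal (fun i => 1 + Δt / 2 * d i) * Q⁻¹ := by
    have : Matrix.diagonal (fun i => 1 + Δt / 2 * d i)
        = (1 : Matrix (Fin N) (Fin N) ℝ) + (Δt / 2) • Matrix.diagonal d := by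
      rw [← Matrix.diagonal_one, ← Matrix.diagonal_smul, Matrix.diagonal_add]; rfl
    rw [this, hA, mul_add, add_mul, mul_one, hQQ, mul_smul_comm, smul_mul_assoc]
  have hminus : (1 : Matrix (Fin N) (Fin N) ℝ) - (Δt / 2) • A
      = Q * Matrix.diagonal (fun i => 1 - Δt / 2 * d i) * Q⁻¹ := by
    have : Matrix.diagonal (fun i => 1 - Δt / 2 * d i)
        = (1 : Matrix (Fin N) (Fin N) ℝ) - (Δt / 2) • Matrix.diagonal d := by
      rw [← Matrix.diagonal_one, ← Matrix.diagonal_smul, Matrix.diagonal_sub]; rfl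
    rw [this, hA, mul_sub, sub_mul, mul_one, hQQ, mul_smul_comm, smul_mul_assoc]
  refine ⟨?_, ?_⟩
  · rw [hplus]
    refine (hQ.mul ?_).mul (IsUnit.of_mul_eq_one Q hQQ')
    rw [Matrix.isUnit_diagonal, Pi.isUnit_iff]
    exact fun i => (hpos i).ne'.isUnit
  intro e hstep hinit
  -- one step in the transformed variables
  have hone : ∀ k n, n + 1 ≤ Nt →
      ‖Q⁻¹.mulVec (e k (n + 1))‖ ≤ r * ‖Q⁻¹.mulVec (e k n)‖ := by
    intro k n hn
    have h := congrArg (Q⁻¹.mulVec) (hstep k (n + 1) (by omega) hn)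
    rw [hplus, hminus, Matrix.mulVec_mulVec, Matrix.mulVec_mulVec, mul_assoc Q, mul_assoc Q,
      ← mul_assoc Q⁻¹, ← mul_assoc Q⁻¹, hQQ', one_mul, one_mul,
      ← Matrix.mulVec_mulVec, ← Matrix.mulVec_mulVec, Nat.add_sub_cancel] at h
    refine (pi_norm_le_iff_of_nonneg (by positivity)).mpr fun i => ?_
    have hi := congrFun h i
    rw [Matrix.mulVec_diagonal, Matrix.mulVec_diagonal] at hi
    have h3 := congrArg abs hi
    rw [abs_mul, abs_mul, abs_of_pos (hpos i)] at h3
    have h4 := norm_le_pi_norm (Q⁻¹.mulVec (e k n)) i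
    rw [Real.norm_eq_abs] at h4 ⊢
    refine le_of_mul_le_mul_left ?_ (hpos i)
    calc _ = _ := h3
      _ ≤ r * (1 + Δt / 2 * d i) * ‖Q⁻¹.mulVec (e k n)‖ :=
        mul_le_mul (hbd i) h4 (abs_nonneg _) (mul_nonneg hr0 (hpos i).le)
      _ = _ := by ring
  have hpow : ∀ k n, n ≤ Nt → ‖Q⁻¹.mulVec (e k n)‖ ≤ r ^ n * ‖Q⁻¹.mulVec (e k 0)‖ := by
    intro k n
    induction n with
    | zero => intro _; simp
    | succ n ih =>
      intro hn
      calc _ ≤ _ := hone k n hn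
        _ ≤ r * (r ^ n * ‖Q⁻¹.mulVec (e k 0)‖) :=
          mul_le_mul_of_nonneg_left (ih (by omega)) hr0
        _ = _ := by ring
  have hrec : ∀ k, ‖Q⁻¹.mulVec (e k 0)‖
      ≤ (|α| * r ^ Nt / (1 - |α| * r ^ Nt)) ^ k * ‖Q⁻¹.mulVec (e 0 0)‖ := by
    intro k
    induction k with
    | zero => simp
    | succ k ih =>
      have h := hinit (k + 1) (by omega)
      rw [Nat.add_sub_cancel] at h
      have h1 : ‖Q⁻¹.mulVec (e (k + 1) 0)‖
          ≤ |α| * (‖Q⁻¹.mulVec (e (k + 1) Nt)‖ + ‖Q⁻¹.mulVec (e k Nt)‖) := by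
        rw [h, Matrix.mulVec_smul, Matrix.mulVec_sub, norm_smul, Real.norm_eq_abs]
        exact mul_le_mul_of_nonneg_left (norm_sub_le _ _) (abs_nonneg _)
      have h2 := mul_le_mul_of_nonneg_left
        (add_le_add (hpow (k + 1) Nt le_rfl) (hpow k Nt le_rfl)) (abs_nonneg α)
      have h3 : ‖Q⁻¹.mulVec (e (k + 1) 0)‖
          ≤ |α| * r ^ Nt / (1 - |α| * r ^ Nt) * ‖Q⁻¹.mulVec (e k 0)‖ := by
        rw [div_mul_eq_mul_div, le_div_iff₀ (by linarith)]
        linarith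
      have hρ : 0 ≤ |α| * r ^ Nt / (1 - |α| * r ^ Nt) :=
        div_nonneg (by positivity) (by linarith)
      calc _ ≤ _ := h3
        _ ≤ _ := mul_le_mul_of_nonneg_left ih hρ
        _ = _ := by ring
  intro k _ n _ hn
  calc _ ≤ _ := hpow k n hn
    _ ≤ r ^ Nt * ((|α| * r ^ Nt / (1 - |α| * r ^ Nt)) ^ k * ‖Q⁻¹.mulVec (e 0 0)‖) :=
      mul_le_mul (pow_le_pow_right₀ hr1 hn) (hrec k) (norm_nonneg _) (by positivity)
    _ = _ := by ring
end

section
/- (Error estimate at semi-discrete level for the nonlinear Cahn–Hilliard equation.) Let N ≥ 1, T > 0, L > 0, and let H : ℝ × ℝ^N → ℝ^N satisfy the one-sided Lipschitz condition ⟨H(t,x) − H(t,y), x − y⟩ ≤ −L ‖x − y‖² for all t ∈ [0,T] and all x, y ∈ ℝ^N. Let α be a real number with |α| < 1. Let u : [0,T] → ℝ^N be differentiable with u'(t) = H(t, u(t)) on [0,T], and for each k ≥ 0 let u^k : [0,T] → ℝ^N be differentiable with (u^k)'(t) = H(t, u^k(t)) on [0,T], and suppose u^k(0) = α (u^k(T)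 − u^{k−1}(T)) + u(0) for all k ≥ 1. Then the errors e^k(t) = u^k(t) − u(t) satisfy, for every k ≥ 1, max_{t∈[0,T]} ‖e^k(t)‖ ≤ ( |α| e^{−LT} / (1 − |α| e^{−LT}) )^k ‖e^0(0)‖. -/
open scoped RealInnerProductSpace

/-- Exponential contraction between two trajectories. -/
theorem decay_aux {N : ℕ} {T L : ℝ}
    {H : ℝ → EuclideanSpace ℝ (Fin N) → EuclideanSpace ℝ (Fin N)}
    (hH : ∀ t ∈ Set.Icc (0 : ℝ) T, ∀ x y : EuclideanSpace ℝ (Fin N),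
      ⟪H t x - H t y, x - y⟫ ≤ -L * ‖x - y‖ ^ 2)
    {u v : ℝ → EuclideanSpace ℝ (Fin N)}
    (hu : ∀ t ∈ Set.Icc (0 : ℝ) T, HasDerivAt u (H t (u t)) t)
    (hv : ∀ t ∈ Set.Icc (0 : ℝ) T, HasDerivAt v (H t (v t)) t)
    {t : ℝ} (ht : t ∈ Set.Icc (0 : ℝ) T) :
    ‖v t - u t‖ ≤ Real.exp (-L * t) * ‖v 0 - u 0‖ := by
  have hd : ∀ s ∈ Set.Icc (0 : ℝ) T,
      HasDerivAt (fun s => Real.exp (2 * L * s) * ‖v s - u s‖ ^ 2)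
        (Real.exp (2 * L * s) * (2 * L) * ‖v s - u s‖ ^ 2
          + Real.exp (2 * L * s) * (2 * ⟪v s - u s, H s (v s) - H s (u s)⟫)) s := by
    intro s hs
    have h1 : HasDerivAt (fun s : ℝ => Real.exp (2 * L * s)) (Real.exp (2 * L * s) * (2 * L)) s := by
      have := ((hasDerivAt_id s).const_mul (2 * L)).exp
      simpa using this
    exact h1.mul ((hv s hs).sub (hu s hs)).norm_sq
  have hanti : AntitoneOn (fun s => Real.exp (2 * L * s) * ‖v s - u s‖ ^ 2) (Set.Icc 0 T) := by
    apply antitoneOn_of_deriv_nonpos (convex_Icc 0 T)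
    · exact fun s hs => (hd s hs).continuousAt.continuousWithinAt
    · exact fun s hs => (hd s (interior_subset hs)).differentiableAt.differentiableWithinAt
    · intro s hs
      have hs' := interior_subset hs
      rw [(hd s hs').deriv]
      have h := hH s hs' (v s) (u s)
      rw [real_inner_comm] at h
      have hp := Real.exp_pos (2 * L * s)
      have := mul_le_mul_of_nonneg_left h hp.le
      linarith
  have h := hanti (Set.left_mem_Icc.2 (ht.1.trans ht.2)) ht ht.1
  simp only [mul_zero, Real.exp_zero, one_mul] at h
  have he : Real.exp (2 * L * t) = Real.exp (L * t) ^ 2 := by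
    rw [← Real.exp_nat_mul]; congr 1; push_cast; ring
  rw [he, ← mul_pow] at h
  have h2 : Real.exp (L * t) * ‖v t - u t‖ ≤ ‖v 0 - u 0‖ :=
    le_of_sq_le_sq h (norm_nonneg _)
  calc ‖v t - u t‖ = Real.exp (-L * t) * (Real.exp (L * t) * ‖v t - u t‖) := by
        rw [← mul_assoc, ← Real.exp_add]; simp
    _ ≤ _ := mul_le_mul_of_nonneg_left h2 (Real.exp_pos _).le

/-- Error estimate at semi-discrete level for the PinT waveform-relaxation
iteration for the nonlinear Cahn–Hilliard equation, under the one-sided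
Lipschitz condition with constant `-L`, `L > 0`. -/
theorem nonlinear_CH_pint_semidiscrete_error_estimate
    (N : ℕ) (hN : 1 ≤ N) (T L : ℝ) (hT : 0 < T) (hL : 0 < L)
    (H : ℝ → EuclideanSpace ℝ (Fin N) → EuclideanSpace ℝ (Fin N))
    (hH : ∀ t ∈ Set.Icc (0 : ℝ) T, ∀ x y : EuclideanSpace ℝ (Fin N),
      ⟪H t x - H t y, x - y⟫ ≤ -L * ‖x - y‖ ^ 2)
    (α : ℝ) (hα : |α| < 1)
    (u : ℝ → EuclideanSpace ℝ (Fin N))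
    (hu : ∀ t ∈ Set.Icc (0 : ℝ) T, HasDerivAt u (H t (u t)) t)
    (uk : ℕ → ℝ → EuclideanSpace ℝ (Fin N))
    (huk : ∀ k : ℕ, ∀ t ∈ Set.Icc (0 : ℝ) T, HasDerivAt (uk k) (H t (uk k t)) t)
    (hcoupling : ∀ k : ℕ, 1 ≤ k →
      uk k 0 = α • (uk k T - uk (k - 1) T) + u 0) :
    ∀ k : ℕ, 1 ≤ k → ∀ t ∈ Set.Icc (0 : ℝ) T,
      ‖uk k t - u t‖
        ≤ (|α| * Real.exp (-L * T) / (1 - |α| * Real.exp (-L * T))) ^ k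
          * ‖uk 0 0 - u 0‖ := by
  have hTm : T ∈ Set.Icc (0 : ℝ) T := ⟨hT.le, le_rfl⟩
  have hq1 : Real.exp (-L * T) ≤ 1 := Real.exp_le_one_iff.2 (by nlinarith)
  have hq0 : 0 < Real.exp (-L * T) := Real.exp_pos _
  have hdec : ∀ k, ‖uk k T - u T‖ ≤ Real.exp (-L * T) * ‖uk k 0 - u 0‖ :=
    fun k => decay_aux hH hu (huk k) hTm
  generalize Real.exp (-L * T) = q at *
  have hα0 := abs_nonneg α
  have hpos : 0 < 1 - |α| * q := by nlinarith
  have key : ∀ k, ‖uk k 0 - u 0‖ ≤ (|α| * q / (1 - |α| * q)) ^ k * ‖uk 0 0 - u 0‖ := by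
    intro k
    induction k with
    | zero => simp
    | succ k ih =>
      have h0 : uk (k + 1) 0 - u 0 = α • ((uk (k + 1) T - u T) - (uk k T - u T)) := by
        rw [hcoupling (k + 1) (by omega)]
        simp
      have h1 : ‖uk (k + 1) 0 - u 0‖
          ≤ |α| * (q * ‖uk (k + 1) 0 - u 0‖ + q * ‖uk k 0 - u 0‖) := by
        conv_lhs => rw [h0, norm_smul, Real.norm_eq_abs]
        exact mul_le_mul_of_nonneg_left
          ((norm_sub_le _ _).trans (add_le_add (hdec _) (hdec _))) hα0
      have h2 : ‖uk (k + 1) 0 - u 0‖ ≤ |α| * q / (1 - |α| * q) * ‖uk k 0 - u 0‖ := by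
        rw [div_mul_eq_mul_div, le_div_iff₀ hpos]
        linarith
      rw [pow_succ', mul_assoc]
      exact h2.trans (mul_le_mul_of_nonneg_left ih (by positivity))
  intro k _ t ht
  have h1 := decay_aux hH hu (huk k) ht
  have h2 : Real.exp (-L * t) ≤ 1 := Real.exp_le_one_iff.2 (by nlinarith [ht.1])
  exact (h1.trans (mul_le_of_le_one_left (norm_nonneg _) h2)).trans (key k)
end

section
/- (Error estimate at fully discrete level for the nonlinear Cahn–Hilliard equation.) Let N ≥ 1, N_t ≥ 1, Δt > 0, L > 0, and set t_n = nΔt for n = 1,…,N_t. Let H : ℝ × ℝ^N → ℝ^N satisfy ⟨H(t_n,x) − H(t_n,y), x − y⟩ ≤ −L ‖x − y‖² for all n = 1,…,N_t and all x, y ∈ ℝ^N. Let α be a real number with |α| < 1. Let u_0, …, u_{N_t} ∈ ℝ^N satisfy (u_n − u_{n−1})/Δt = H(t_n, u_n) for n = 1,…,N_t, and for each k ≥ 0 let u_0^k, …, u_{N_t}^k ∈ ℝ^N satisfy (u_n^k − u_{n−1}^k)/Δt = H(t_n, u_n^k) for n = 1,…,N_t, with u_0^k = α (u_{N_t}^k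 − u_{N_t}^{k−1}) + u_0 for all k ≥ 1. Then the errors e_n^k = u_n^k − u_n satisfy, for every k ≥ 1, max_{1 ≤ n ≤ N_t} ‖e_n^k‖ ≤ ρ^k ‖e_0^0‖, where ρ = |α| C₁ / (1 − |α| C₁) and C₁ = (1 + 2LΔt)^{−N_t/2}. -/
open scoped RealInnerProductSpace

/-- Error estimate at fully discrete level for the PinT iteration for the
nonlinear Cahn–Hilliard equation (fully implicit backward Euler), with
convergence factor `ρ = |α|C₁/(1 - |α|C₁)`, `C₁ = (1 + 2LΔt)^{-N_t/2}`. -/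
theorem nonlinear_CH_pint_fully_discrete_error_estimate
    (N Nt : ℕ) (hN : 1 ≤ N) (hNt : 1 ≤ Nt) (Δt L : ℝ) (hΔt : 0 < Δt) (hL : 0 < L)
    (H : ℝ → EuclideanSpace ℝ (Fin N) → EuclideanSpace ℝ (Fin N))
    (hH : ∀ n : ℕ, 1 ≤ n → n ≤ Nt → ∀ x y : EuclideanSpace ℝ (Fin N),
      ⟪H (n * Δt) x - H (n * Δt) y, x - y⟫ ≤ -L * ‖x - y‖ ^ 2)
    (α : ℝ) (hα : |α| < 1)
    (u : ℕ → EuclideanSpace ℝ (Fin N))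
    (hu : ∀ n : ℕ, 1 ≤ n → n ≤ Nt →
      Δt⁻¹ • (u n - u (n - 1)) = H (n * Δt) (u n))
    (uk : ℕ → ℕ → EuclideanSpace ℝ (Fin N))
    (huk : ∀ k : ℕ, ∀ n : ℕ, 1 ≤ n → n ≤ Nt →
      Δt⁻¹ • (uk k n - uk k (n - 1)) = H (n * Δt) (uk k n))
    (hcoupling : ∀ k : ℕ, 1 ≤ k →
      uk k 0 = α • (uk k Nt - uk (k - 1) Nt) + u 0)
    (C₁ : ℝ) (hC₁ : C₁ = (1 + 2 * L * Δt) ^ (-(Nt : ℝ) / 2)) :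
    ∀ k : ℕ, 1 ≤ k → ∀ n : ℕ, 1 ≤ n → n ≤ Nt →
      ‖uk k n - u n‖ ≤ (|α| * C₁ / (1 - |α| * C₁)) ^ k * ‖uk 0 0 - u 0‖ := by
  have hLt : 0 < L * Δt := mul_pos hL hΔt
  have hq0 : 0 < 1 + 2 * L * Δt := by nlinarith
  have hq1 : 1 ≤ 1 + 2 * L * Δt := by nlinarith
  have hC0 : 0 < C₁ := by rw [hC₁]; exact Real.rpow_pos_of_pos hq0 _
  have hC1 : C₁ ≤ 1 := by
    rw [hC₁]
    apply Real.rpow_le_one_of_one_le_of_nonpos hq1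
    have : (0 : ℝ) ≤ (Nt : ℝ) := Nat.cast_nonneg _
    linarith
  have hCsq : C₁ ^ 2 * (1 + 2 * L * Δt) ^ Nt = 1 := by
    rw [hC₁, ← Real.rpow_natCast _ 2, ← Real.rpow_mul hq0.le, ← Real.rpow_natCast _ Nt,
      ← Real.rpow_add hq0]
    have : -(Nt : ℝ) / 2 * ((2 : ℕ) : ℝ) + (Nt : ℝ) = 0 := by push_cast; ring
    rw [this, Real.rpow_zero]
  have step : ∀ k n : ℕ, n + 1 ≤ Nt →
      (1 + 2 * L * Δt) * ‖uk k (n + 1) - u (n + 1)‖ ^ 2 ≤ ‖uk k n - u n‖ ^ 2 := by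
    intro k n hn
    have h1 := hH (n + 1) (by omega) hn (uk k (n + 1)) (u (n + 1))
    rw [← hu (n + 1) (by omega) hn, ← huk k (n + 1) (by omega) hn, Nat.add_sub_cancel,
      ← smul_sub, real_inner_smul_left] at h1
    have e : uk k (n + 1) - uk k n - (u (n + 1) - u n)
        = (uk k (n + 1) - u (n + 1)) - (uk k n - u n) := by abel
    rw [e] at h1
    generalize uk k (n + 1) - u (n + 1) = a at *
    generalize uk k n - u n = b at *
    rw [inv_mul_le_iff₀ hΔt, inner_sub_left, real_inner_self_eq_norm_sq] at h1
    have h2 := real_inner_le_norm b a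
    nlinarith [sq_nonneg (‖a‖ - ‖b‖)]
  have iter : ∀ k n : ℕ, n ≤ Nt →
      (1 + 2 * L * Δt) ^ n * ‖uk k n - u n‖ ^ 2 ≤ ‖uk k 0 - u 0‖ ^ 2 := by
    intro k n
    induction n with
    | zero => intro _; simp
    | succ n ih =>
      intro hn
      refine le_trans ?_ (ih (by omega))
      rw [pow_succ, mul_assoc]
      exact mul_le_mul_of_nonneg_left (step k n hn) (by positivity)
  have hle : ∀ k n : ℕ, n ≤ Nt → ‖uk k n - u n‖ ≤ ‖uk k 0 - u 0‖ := by
    intro k n hn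
    refine (fun h1 h2 => (sq_le_sq₀ (norm_nonneg _) h2).1 h1) ?_ (norm_nonneg _)
    refine le_trans ?_ (iter k n hn)
    exact le_mul_of_one_le_left (by positivity) (one_le_pow₀ hq1)
  have hend : ∀ k : ℕ, ‖uk k Nt - u Nt‖ ≤ C₁ * ‖uk k 0 - u 0‖ := by
    intro k
    refine (fun h1 h2 => (sq_le_sq₀ (norm_nonneg _) h2).1 h1) ?_ (by positivity)
    have h := mul_le_mul_of_nonneg_left (iter k Nt le_rfl) (sq_nonneg C₁)
    rw [← mul_assoc, hCsq, one_mul] at h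
    rwa [mul_pow]
  have hd : 0 < 1 - |α| * C₁ := by nlinarith [abs_nonneg α]
  have hstep : ∀ k : ℕ, ‖uk (k + 1) 0 - u 0‖
      ≤ (|α| * C₁ / (1 - |α| * C₁)) * ‖uk k 0 - u 0‖ := by
    intro k
    have h1 : uk (k + 1) 0 - u 0 = α • ((uk (k + 1) Nt - u Nt) - (uk k Nt - u Nt)) := by
      rw [hcoupling (k + 1) (by omega), Nat.add_sub_cancel, add_sub_cancel_right,
        sub_sub_sub_cancel_right]
    have h2 : ‖uk (k + 1) 0 - u 0‖
        ≤ |α| * (C₁ * ‖uk (k + 1) 0 - u 0‖ + C₁ * ‖uk k 0 - u 0‖) := by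
      conv_lhs => rw [h1, norm_smul, Real.norm_eq_abs]
      exact mul_le_mul_of_nonneg_left
        ((norm_sub_le _ _).trans (add_le_add (hend _) (hend _))) (abs_nonneg _)
    rw [div_mul_eq_mul_div, le_div_iff₀ hd]
    nlinarith
  have hρ : 0 ≤ |α| * C₁ / (1 - |α| * C₁) := by positivity
  have hall : ∀ k : ℕ, ‖uk k 0 - u 0‖
      ≤ (|α| * C₁ / (1 - |α| * C₁)) ^ k * ‖uk 0 0 - u 0‖ := by
    intro k
    induction k with
    | zero => simp
    | succ k ih =>
      refine (hstep k).trans ?_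
      rw [pow_succ', mul_assoc]
      exact mul_le_mul_of_nonneg_left ih hρ
  intro k _ n _ hn
  exact (hle k n hn).trans (hall k)
end

section
/- (Core estimate of the continuous-level convergence theorem for the nonlinear Cahn–Hilliard equation.) Let T > 0, C > 0, and let α be a real number with 2|α| e^{CT} < 1. For each k ≥ 0 let v^k : [0,T] → [0,∞) be a function such that v^k(t) ≤ e^{Ct} v^k(0) for all t ∈ [0,T] and all k ≥ 0, and v^k(0) ≤ |α| ( v^k(T) + v^{k−1}(T) ) for all k ≥ 1. Then, with γ = |α| e^{CT} / (1 − |α| e^{CT}), one has γ < 1, v^k(0) ≤ γ^k v^0(0) for all k ≥ 0, and consequently sup_{t∈[0,T]} v^k(t) ≤ e^{CT} γ^k v^0(0), so that sup_{t∈[0,T]} v^k(t) → 0 as k → ∞. -/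
open Filter

/-- Core estimate of the continuous-level convergence theorem for the nonlinear
Cahn–Hilliard equation: with `γ = |α|e^{CT}/(1 - |α|e^{CT})` one has `γ < 1`,
`v^k(0) ≤ γ^k v^0(0)`, `sup_{[0,T]} v^k ≤ e^{CT} γ^k v^0(0)`, and the sup tends
to `0`. -/
theorem nonlinear_CH_pint_continuous_core_estimate
    (T C : ℝ) (hT : 0 < T) (hC : 0 < C)
    (α : ℝ) (hα : 2 * |α| * Real.exp (C * T) < 1)
    (v : ℕ → ℝ → ℝ)
    (hvnonneg : ∀ k : ℕ, ∀ t ∈ Set.Icc (0 : ℝ) T, 0 ≤ v k t)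
    (hgrowth : ∀ k : ℕ, ∀ t ∈ Set.Icc (0 : ℝ) T, v k t ≤ Real.exp (C * t) * v k 0)
    (hrec : ∀ k : ℕ, 1 ≤ k → v k 0 ≤ |α| * (v k T + v (k - 1) T))
    (γ : ℝ) (hγ : γ = |α| * Real.exp (C * T) / (1 - |α| * Real.exp (C * T))) :
    γ < 1
      ∧ (∀ k : ℕ, v k 0 ≤ γ ^ k * v 0 0)
      ∧ (∀ k : ℕ, ∀ t ∈ Set.Icc (0 : ℝ) T,
          v k t ≤ Real.exp (C * T) * γ ^ k * v 0 0)
      ∧ Tendsto (fun k : ℕ => ⨆ t ∈ Set.Icc (0 : ℝ) T, v k t) atTop (nhds 0) := by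
  set q := |α| * Real.exp (C * T) with hq
  have hq0 : 0 ≤ q := by positivity
  have hq2 : 2 * q < 1 := by rw [hq]; linarith
  have h1q : 0 < 1 - q := by linarith
  have hγ0 : 0 ≤ γ := by rw [hγ]; positivity
  have hγ1 : γ < 1 := by rw [hγ, div_lt_one h1q]; linarith
  have hTm : T ∈ Set.Icc (0 : ℝ) T := ⟨hT.le, le_rfl⟩
  have h0m : (0 : ℝ) ∈ Set.Icc (0 : ℝ) T := ⟨le_rfl, hT.le⟩
  have hb : ∀ k : ℕ, v k 0 ≤ γ ^ k * v 0 0 := by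
    intro k
    induction k with
    | zero => simp
    | succ n ih =>
      have h1 := hrec (n + 1) (by omega)
      rw [Nat.add_sub_cancel] at h1
      have h2 : |α| * (v (n + 1) T + v n T) ≤ q * v (n + 1) 0 + q * v n 0 := by
        have := mul_le_mul_of_nonneg_left
          (add_le_add (hgrowth (n + 1) T hTm) (hgrowth n T hTm)) (abs_nonneg α)
        rw [hq]; linarith
      have h3 : v (n + 1) 0 ≤ γ * v n 0 := by
        rw [hγ, div_mul_eq_mul_div, le_div_iff₀ h1q]; linarith
      have h4 := mul_le_mul_of_nonneg_left ih hγ0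
      rw [pow_succ]; linarith
  have hs : ∀ k : ℕ, ∀ t ∈ Set.Icc (0 : ℝ) T,
      v k t ≤ Real.exp (C * T) * γ ^ k * v 0 0 := by
    intro k t ht
    have he : Real.exp (C * t) ≤ Real.exp (C * T) :=
      Real.exp_le_exp.mpr (mul_le_mul_of_nonneg_left ht.2 hC.le)
    calc v k t ≤ Real.exp (C * t) * v k 0 := hgrowth k t ht
      _ ≤ Real.exp (C * T) * v k 0 := mul_le_mul_of_nonneg_right he (hvnonneg k 0 h0m)
      _ ≤ Real.exp (C * T) * (γ ^ k * v 0 0) :=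
        mul_le_mul_of_nonneg_left (hb k) (Real.exp_pos _).le
      _ = _ := by ring
  refine ⟨hγ1, hb, hs, ?_⟩
  have hlim : Tendsto (fun k : ℕ => Real.exp (C * T) * γ ^ k * v 0 0) atTop (nhds 0) := by
    have := ((tendsto_pow_atTop_nhds_zero_of_lt_one hγ0 hγ1).const_mul
      (Real.exp (C * T))).mul_const (v 0 0)
    simpa using this
  have hv0 := hvnonneg 0 0 h0m
  refine squeeze_zero (fun k => ?_) (fun k => ?_) hlim
  · exact Real.iSup_nonneg fun t => Real.iSup_nonneg fun ht => hvnonneg k t ht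
  · have hp : 0 ≤ Real.exp (C * T) * γ ^ k * v 0 0 := by positivity
    exact Real.iSup_le (fun t => Real.iSup_le (fun ht => hs k t ht) hp) hp
end

section
/- (Continuous-level convergence factor for the general fourth-order equation u_t = −Δ²u + Δu, in Fourier modes.) Let T > 0, and let ω_min > 0 and α be real numbers with |α| < 1. Let (ω_n)_{n∈ℤ} be real numbers with |ω_n| ≥ ω_min for all n. For each k ≥ 0 let ê^k(t) ∈ ℓ² for every t ∈ [0,T], with modes satisfying ê^k_n(t) = e^{−(ω_n² + ω_n⁴) t} ê^k_n(0) for all n ∈ ℤ, t ∈ [0,T], k ≥ 0, together with the PinT coupling ê^k_n(0) = α (ê^k_n(T) − ê^{k−1}_n(T)) for all n ∈ ℤ and k ≥ 1. Then for every k ≥ 1 and every t ∈ [0,T], ‖ê^k(t)‖_{ℓ²} ≤ ρ^k ‖ê^0(0)‖_{ℓ²}, where ρ = |α| e^{−(ω_min² + ω_min⁴)T} / (1 − |α| e^{−(ω_min² + ω_min⁴)T}). -/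
/-- Continuous-level convergence factor for the PinT iteration for the general
fourth-order equation `u_t = -Δ²u + Δu`, in Fourier modes. -/
theorem general_fourth_order_pint_continuous_error_estimate
    (T ωmin : ℝ) (hT : 0 < T) (hωmin : 0 < ωmin)
    (α : ℝ) (hα : |α| < 1)
    (ω : ℤ → ℝ) (hω : ∀ n, ωmin ≤ |ω n|)
    (e : ℕ → ℝ → lp (fun _ : ℤ => ℂ) 2)
    (hmode : ∀ k : ℕ, ∀ n : ℤ, ∀ t ∈ Set.Icc (0 : ℝ) T,
      (e k t : ∀ _ : ℤ, ℂ) n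
        = (Real.exp (-((ω n) ^ 2 + (ω n) ^ 4) * t) : ℝ) * (e k 0 : ∀ _ : ℤ, ℂ) n)
    (hcoupling : ∀ k : ℕ, 1 ≤ k → ∀ n : ℤ,
      (e k 0 : ∀ _ : ℤ, ℂ) n
        = (α : ℂ) * ((e k T : ∀ _ : ℤ, ℂ) n - (e (k - 1) T : ∀ _ : ℤ, ℂ) n)) :
    ∀ k : ℕ, 1 ≤ k → ∀ t ∈ Set.Icc (0 : ℝ) T,
      ‖e k t‖ ≤ (|α| * Real.exp (-(ωmin ^ 2 + ωmin ^ 4) * T)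
          / (1 - |α| * Real.exp (-(ωmin ^ 2 + ωmin ^ 4) * T))) ^ k * ‖e 0 0‖ := by
  set q := Real.exp (-(ωmin ^ 2 + ωmin ^ 4) * T) with hq
  have hq0 : 0 < q := Real.exp_pos _
  have hq1 : q ≤ 1 := Real.exp_le_one_iff.2 (by
    have : 0 ≤ (ωmin ^ 2 + ωmin ^ 4) * T := by positivity
    linarith)
  have ha0 : 0 ≤ |α| := abs_nonneg α
  have hd : 0 < 1 - |α| * q := by nlinarith
  set ρ := |α| * q / (1 - |α| * q) with hρ
  have hρ0 : 0 ≤ ρ := by positivity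
  have hT' : T ∈ Set.Icc (0 : ℝ) T := ⟨hT.le, le_rfl⟩
  have step : ∀ k n, ‖(e (k + 1) 0 : ∀ _ : ℤ, ℂ) n‖ ≤ ρ * ‖(e k 0 : ∀ _ : ℤ, ℂ) n‖ := by
    intro k n
    have h := hcoupling (k + 1) (by omega) n
    rw [Nat.add_sub_cancel, hmode (k + 1) n T hT', hmode k n T hT', ← mul_sub] at h
    have hle : Real.exp (-((ω n) ^ 2 + (ω n) ^ 4) * T) ≤ q := by
      apply Real.exp_le_exp.2
      have h2 : ωmin ^ 2 ≤ ω n ^ 2 := by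
        rw [← sq_abs (ω n)]
        exact pow_le_pow_left₀ hωmin.le (hω n) 2
      have h4 : ωmin ^ 4 ≤ ω n ^ 4 := by
        have := pow_le_pow_left₀ (sq_nonneg ωmin) h2 2
        nlinarith
      nlinarith
    have hp := Real.exp_pos (-((ω n) ^ 2 + (ω n) ^ 4) * T)
    have h' := congrArg norm h
    rw [norm_mul, norm_mul, Complex.norm_real, Complex.norm_real, Real.norm_eq_abs,
      Real.norm_eq_abs, abs_of_pos hp] at h'
    have hs := norm_sub_le ((e (k + 1) 0 : ∀ _ : ℤ, ℂ) n) ((e k 0 : ∀ _ : ℤ, ℂ) n)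
    have h3 : ‖(e (k + 1) 0 : ∀ _ : ℤ, ℂ) n‖
        ≤ |α| * (q * (‖(e (k + 1) 0 : ∀ _ : ℤ, ℂ) n‖ + ‖(e k 0 : ∀ _ : ℤ, ℂ) n‖)) := by
      refine h'.le.trans ?_
      gcongr
    rw [hρ, div_mul_eq_mul_div, le_div_iff₀ hd]
    linarith
  have iter : ∀ k n, ‖(e k 0 : ∀ _ : ℤ, ℂ) n‖ ≤ ρ ^ k * ‖(e 0 0 : ∀ _ : ℤ, ℂ) n‖ := by
    intro k n
    induction k with
    | zero => simp
    | succ k ih =>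
      calc _ ≤ _ := step k n
        _ ≤ ρ * (ρ ^ k * ‖(e 0 0 : ∀ _ : ℤ, ℂ) n‖) := by gcongr
        _ = _ := by ring
  intro k _ t ht
  have hpt : ∀ n, ‖(e k t : ∀ _ : ℤ, ℂ) n‖
      ≤ ‖(((ρ ^ k : ℝ) : ℂ) • e 0 0 : lp (fun _ : ℤ => ℂ) 2) n‖ := by
    intro n
    rw [hmode k n t ht, norm_mul, Complex.norm_real, Real.norm_eq_abs, Real.abs_exp,
      lp.coeFn_smul, Pi.smul_apply, norm_smul, Complex.norm_real, Real.norm_eq_abs,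
      abs_of_nonneg (pow_nonneg hρ0 k)]
    have h1 : Real.exp (-((ω n) ^ 2 + (ω n) ^ 4) * t) ≤ 1 := Real.exp_le_one_iff.2 (by
      have := mul_nonneg (by positivity : 0 ≤ (ω n) ^ 2 + (ω n) ^ 4) ht.1
      linarith)
    exact (mul_le_of_le_one_left (norm_nonneg _) h1).trans (iter k n)
  have := lp.norm_mono (p := 2) (by norm_num) hpt
  rwa [norm_smul, Complex.norm_real, Real.norm_eq_abs, abs_of_nonneg (pow_nonneg hρ0 k)] at this
end
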